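/- Let T > e and μ_T = (log T)^{1/4}. Let ξ_T : L_T → (0,∞) be any potential, let z ∈ L_T, and suppose h_T(z) = ∑_{j=1}^n q|y_{j−1} − y_j|/ξ_T(y_j) for pairwise distinct points y_0, …, y_n ∈ L_T with y_0 = z and y_n = 0. Define n' = 0 if ξ_T(y_j) < μ_T³/a(T) for all j ≥ 1, and n' = max{j ≥ 1 : ξ_T(y_j) ≥ μ_T³/a(T)} otherwise. Then for any z_0 ∈ L_T with ξ_T(z_0) ≥ 2μ_T³/a(T): q|y_{n'}|/ξ_T(z_0) ≤ h_T(z_0) + q|z_0|/ξ_T(z_0). -/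

import Mathlib

open MeasureTheory ProbabilityTheory Real

noncomputable section

/-- The ℓ¹-norm on `ℝ^d`. -/
def l1 {d : ℕ} (z : Fin d → ℝ) : ℝ := ∑ i, |z i|

/-- Membership in the rescaled lattice `L_T = {z ∈ ℝ^d : r(T) z ∈ ℤ^d}`. -/
def inLatt {d : ℕ} (rT : ℝ) (z : Fin d → ℝ) : Prop := ∀ i, ∃ m : ℤ, rT * z i = (m : ℝ)

/-- The rescaled potential `ξ_T(z) = ξ(r(T) z) / a(T)` built from the environment `ξ` on `ℤ^d`. -/
def envPot {Ω : Type*} {d : ℕ} (aT rT : ℝ) (ξ : (Fin d → ℤ) → Ω → ℝ) (ω : Ω)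
    (z : Fin d → ℝ) : ℝ :=
  ξ (fun i => ⌊rT * z i⌋) ω / aT

/-- The cost `∑_{j=1}^n q|y_{j-1} - y_j| / ξ_T(y_j)` of the path `y 0, …, y n`. -/
def pathCost {d : ℕ} (q : ℝ) (ξT : (Fin d → ℝ) → ℝ) (n : ℕ) (y : ℕ → Fin d → ℝ) : ℝ :=
  ∑ j ∈ Finset.range n, q * l1 (y j - y (j + 1)) / ξT (y (j + 1))

/-- The lilypad hitting time `h_T(z)`. -/
def hitTime {d : ℕ} (q rT : ℝ) (ξT : (Fin d → ℝ) → ℝ) (z : Fin d → ℝ) : ℝ :=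
  sInf {s : ℝ | ∃ n : ℕ, 1 ≤ n ∧ ∃ y : ℕ → Fin d → ℝ,
    (∀ j ≤ n, inLatt rT (y j)) ∧ y 0 = z ∧ y n = 0 ∧ s = pathCost q ξT n y}

/-- The rounding `[x]_T` of `x ∈ ℝ^d` to the lattice `L_T`. -/
def roundT {d : ℕ} (rT : ℝ) (x : Fin d → ℝ) : Fin d → ℝ := fun i => (⌊rT * x i⌋ : ℝ) / rT

/-- The PAM lilypad hitting time `τ_T(z) = inf_y q(|y| + |z-y|)/ξ_T(y)`. -/
def tauT {d : ℕ} (q rT : ℝ) (ξT : (Fin d → ℝ) → ℝ) (z : Fin d → ℝ) : ℝ :=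
  sInf {s : ℝ | ∃ y : Fin d → ℝ, inLatt rT y ∧ s = q * (l1 y + l1 (z - y)) / ξT y}

/-- The BRW lilypad profile `m_T(z,t) = sup_y { ξ_T(y)(t - h_T(y))_+ - q|z-y| }`. -/
def mT {d : ℕ} (q rT : ℝ) (ξT : (Fin d → ℝ) → ℝ) (z : Fin d → ℝ) (t : ℝ) : ℝ :=
  sSup {v : ℝ | ∃ y : Fin d → ℝ, inLatt rT y ∧
    v = ξT y * max (t - hitTime q rT ξT y) 0 - q * l1 (z - y)}

/-- The PAM lilypad profile `λ_T(z,t) = sup_y { ξ_T(y) t - q|y| - q|z-y| } ∨ 0`. -/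
def lamT {d : ℕ} (q rT : ℝ) (ξT : (Fin d → ℝ) → ℝ) (z : Fin d → ℝ) (t : ℝ) : ℝ :=
  max (sSup {v : ℝ | ∃ y : Fin d → ℝ, inLatt rT y ∧
    v = ξT y * t - q * l1 y - q * l1 (z - y)}) 0

/-- `a(T) = (T / log T)^q`. -/
def aOf (q T : ℝ) : ℝ := (T / Real.log T) ^ q

/-- `r(T) = (T / log T)^(q+1)`. -/
def rOf (q T : ℝ) : ℝ := (T / Real.log T) ^ (q + 1)

end

section LilypadPaths

variable {d : ℕ}

lemma l1_nonneg (z : Fin d → ℝ) : 0 ≤ l1 z := Finset.sum_nonneg fun _ _ => abs_nonneg _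

@[simp]
lemma l1_zero : l1 (0 : Fin d → ℝ) = 0 := by simp [l1]

lemma l1_sub_le (u v : Fin d → ℝ) : l1 (u - v) ≤ l1 u + l1 v := by
  rw [l1, l1, l1, ← Finset.sum_add_distrib]
  exact Finset.sum_le_sum fun i _ => abs_sub (u i) (v i)

lemma l1_sub_le_add (u v w : Fin d → ℝ) : l1 (u - w) ≤ l1 (u - v) + l1 (v - w) := by
  rw [l1, l1, l1, ← Finset.sum_add_distrib]
  exact Finset.sum_le_sum fun i _ => abs_sub_le (u i) (v i) (w i)

lemma l1_sub_le_sum (y : ℕ → Fin d → ℝ) (m : ℕ) :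
    l1 (y 0 - y m) ≤ ∑ j ∈ Finset.range m, l1 (y j - y (j + 1)) := by
  induction m with
  | zero => simp
  | succ m ih =>
    rw [Finset.sum_range_succ]
    linarith [l1_sub_le_add (y 0) (y m) (y (m + 1))]

lemma inLatt_zero (rT : ℝ) : inLatt rT (0 : Fin d → ℝ) := fun _ => ⟨0, by simp⟩

lemma pathCost_add (q : ℝ) (ξT : (Fin d → ℝ) → ℝ) (a b : ℕ) (y : ℕ → Fin d → ℝ) :
    pathCost q ξT (a + b) y = pathCost q ξT a y + pathCost q ξT b (fun j => y (a + j)) :=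
  Finset.sum_range_add _ a b

lemma pathCost_congr (q : ℝ) (ξT : (Fin d → ℝ) → ℝ) {n : ℕ} {y w : ℕ → Fin d → ℝ}
    (h : ∀ j ≤ n, y j = w j) : pathCost q ξT n y = pathCost q ξT n w := by
  refine Finset.sum_congr rfl fun j hj => ?_
  have hj := Finset.mem_range.1 hj
  rw [h j hj.le, h (j + 1) hj]

lemma pathCost_nonneg {q rT : ℝ} {ξT : (Fin d → ℝ) → ℝ} (hq : 0 ≤ q)
    (hpos : ∀ z, inLatt rT z → 0 < ξT z) {n : ℕ} {y : ℕ → Fin d → ℝ}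
    (hlatt : ∀ j ≤ n, inLatt rT (y j)) : 0 ≤ pathCost q ξT n y :=
  Finset.sum_nonneg fun _ hj => div_nonneg (mul_nonneg hq (l1_nonneg _))
    (hpos _ (hlatt _ (Finset.mem_range.1 hj))).le

/-- A path through sites of potential at most `c` costs at least as much as a straight move at
rate `c`. -/
lemma le_pathCost_of_le {q c : ℝ} {ξT : (Fin d → ℝ) → ℝ} (hq : 0 ≤ q) {n : ℕ}
    {y : ℕ → Fin d → ℝ} (hpos : ∀ j < n, 0 < ξT (y (j + 1)))
    (hle : ∀ j < n, ξT (y (j + 1)) ≤ c) :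
    q * l1 (y 0 - y n) / c ≤ pathCost q ξT n y := by
  rcases n.eq_zero_or_pos with rfl | hn
  · simp [pathCost]
  have hc : 0 ≤ c := (hpos 0 hn).le.trans (hle 0 hn)
  calc q * l1 (y 0 - y n) / c
      ≤ q * (∑ j ∈ Finset.range n, l1 (y j - y (j + 1))) / c := by
        gcongr
        exact l1_sub_le_sum y n
    _ = ∑ j ∈ Finset.range n, q * l1 (y j - y (j + 1)) / c := by
        rw [Finset.mul_sum, Finset.sum_div]
    _ ≤ pathCost q ξT n y := by
        refine Finset.sum_le_sum fun j hj => ?_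
        have hj := Finset.mem_range.1 hj
        exact div_le_div_of_nonneg_left (mul_nonneg hq (l1_nonneg _)) (hpos j hj) (hle j hj)

lemma hitTime_le_pathCost {q rT : ℝ} {ξT : (Fin d → ℝ) → ℝ} (hq : 0 ≤ q)
    (hpos : ∀ z, inLatt rT z → 0 < ξT z) {n : ℕ} (hn : 1 ≤ n) {y : ℕ → Fin d → ℝ}
    (hlatt : ∀ j ≤ n, inLatt rT (y j)) (hyn : y n = 0) :
    hitTime q rT ξT (y 0) ≤ pathCost q ξT n y := by
  refine csInf_le ⟨0, ?_⟩ ⟨n, hn, y, hlatt, rfl, hyn, rfl⟩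
  rintro _ ⟨k, -, x, hx, -, -, rfl⟩
  exact pathCost_nonneg hq hpos hx

lemma le_hitTime {q rT b : ℝ} {ξT : (Fin d → ℝ) → ℝ} {z : Fin d → ℝ} (hz : inLatt rT z)
    (h : ∀ (k : ℕ) (x : ℕ → Fin d → ℝ), (∀ j ≤ k, inLatt rT (x j)) → x 0 = z → x k = 0 →
      b ≤ pathCost q ξT k x) :
    b ≤ hitTime q rT ξT z := by
  refine le_csInf ⟨_, 1, le_rfl, fun j => if j = 0 then z else 0, ?_, by simp, by simp, rfl⟩ ?_
  · intro j _
    dsimp only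
    split_ifs
    exacts [hz, inLatt_zero rT]
  · rintro _ ⟨k, -, x, hx, hx0, hxk, rfl⟩
    exact h k x hx hx0 hxk

/-- Following a path `y` for `m` steps and then jumping to `z₀` bounds the hitting time of
`y 0` in terms of that of `z₀`. -/
lemma hitTime_le_pathCost_add {q rT : ℝ} {ξT : (Fin d → ℝ) → ℝ} (hq : 0 ≤ q)
    (hpos : ∀ z, inLatt rT z → 0 < ξT z) {m : ℕ} {y : ℕ → Fin d → ℝ}
    (hlatt : ∀ j ≤ m, inLatt rT (y j)) {z₀ : Fin d → ℝ} (hz₀ : inLatt rT z₀) :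
    hitTime q rT ξT (y 0) ≤
      pathCost q ξT m y + q * l1 (y m - z₀) / ξT z₀ + hitTime q rT ξT z₀ := by
  suffices hitTime q rT ξT (y 0) - (pathCost q ξT m y + q * l1 (y m - z₀) / ξT z₀) ≤
      hitTime q rT ξT z₀ by linarith
  refine le_hitTime hz₀ fun k x hx hx0 hxk => ?_
  let w : ℕ → Fin d → ℝ := fun j => if j ≤ m then y j else x (j - (m + 1))
  have hw_head : ∀ j ≤ m, w j = y j := fun j hj => if_pos hj
  have hw_tail : ∀ j, w (m + 1 + j) = x j := fun j => by
    simp only [w]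
    rw [if_neg (by omega), Nat.add_sub_cancel_left]
  have hw_latt : ∀ j ≤ m + 1 + k, inLatt rT (w j) := fun j hj => by
    simp only [w]
    split_ifs with hjm
    exacts [hlatt j hjm, hx _ (by omega)]
  have hle := hitTime_le_pathCost hq hpos (by omega) hw_latt ((hw_tail k).trans hxk)
  have hw_succ : w (m + 1) = z₀ := (hw_tail 0).trans hx0
  rw [hw_head 0 m.zero_le, pathCost_add, pathCost_congr q ξT (fun j _ => hw_tail j),
    pathCost_add, pathCost_congr q ξT hw_head] at hle
  simp only [pathCost, Finset.sum_range_one, add_zero, hw_succ, hw_head m le_rfl] at hle ⊢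
  linarith

end LilypadPaths

lemma aOf_pos (q : ℝ) {T : ℝ} (hT : 1 < T) : 0 < aOf q T :=
  rpow_pos_of_pos (div_pos (by linarith) (log_pos hT)) q

/-- **Lemma 5.4.** With `μ_T = (log T)^{1/4}`, if the infimum defining `h_T(z)` is attained
along distinct points `y 0 = z, …, y n = 0` and `n'` is the last index `j ≥ 1` with
`ξ_T(y j) ≥ μ_T³/a(T)` (and `n' = 0` if there is none), then for any `z₀ ∈ L_T` with
`ξ_T(z₀) ≥ 2μ_T³/a(T)`: `q|y_{n'}|/ξ_T(z₀) ≤ h_T(z₀) + q|z₀|/ξ_T(z₀)`. -/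
theorem travelling_via_z0
    (d : ℕ) (hd : 1 ≤ d) (α : ℝ) (hα : (d : ℝ) < α)
    (q : ℝ) (hq : q = d / (α - d))
    (T : ℝ) (hT : Real.exp 1 < T)
    (aT rT μT : ℝ) (haT : aT = aOf q T) (hrT : rT = rOf q T)
    (hμT : μT = Real.log T ^ ((1 : ℝ) / 4))
    (ξT : (Fin d → ℝ) → ℝ) (hpos : ∀ z, inLatt rT z → 0 < ξT z)
    (z : Fin d → ℝ) (hz : inLatt rT z)
    (n : ℕ) (hn : 1 ≤ n) (y : ℕ → Fin d → ℝ)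
    (hlatt : ∀ j ≤ n, inLatt rT (y j))
    (hy0 : y 0 = z) (hyn : y n = 0)
    (hdist : ∀ i j, i ≤ n → j ≤ n → y i = y j → i = j)
    (hopt : hitTime q rT ξT z = pathCost q ξT n y)
    (n' : ℕ) (hn'le : n' ≤ n)
    (hn'def : (n' = 0 ∧ ∀ j, 1 ≤ j → j ≤ n → ξT (y j) < μT ^ 3 / aT)
      ∨ (1 ≤ n' ∧ μT ^ 3 / aT ≤ ξT (y n') ∧ ∀ j, n' < j → j ≤ n → ξT (y j) < μT ^ 3 / aT))
    (z₀ : Fin d → ℝ) (hz₀ : inLatt rT z₀) (hz₀pot : 2 * μT ^ 3 / aT ≤ ξT z₀) :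
    q * l1 (y n') / ξT z₀ ≤ hitTime q rT ξT z₀ + q * l1 z₀ / ξT z₀ := by
  have hq0 : 0 ≤ q := hq ▸ div_nonneg (Nat.cast_nonneg d) (sub_pos.2 hα).le
  have hT1 : 1 < T := (one_lt_exp_iff.2 one_pos).trans hT
  have haT0 : 0 < aT := haT ▸ aOf_pos q hT1
  have hμT0 : 0 < μT := hμT ▸ rpow_pos_of_pos (log_pos hT1) _
  set c := μT ^ 3 / aT with hc
  have hc0 : 0 < c := by positivity
  have hlow : ∀ j, n' < j → j ≤ n → ξT (y j) < c := by
    rcases hn'def with ⟨rfl, h⟩ | ⟨-, -, h⟩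
    exacts [h, h]
  obtain ⟨m, rfl⟩ := Nat.exists_eq_add_of_le hn'le
  have htail : q * l1 (y n') / c ≤ pathCost q ξT m (fun j => y (n' + j)) := by
    have h := le_pathCost_of_le (c := c) (ξT := ξT) (n := m) (y := fun j => y (n' + j)) hq0
      (fun j hj => hpos _ (hlatt _ (by omega))) (fun j hj => (hlow _ (by omega) (by omega)).le)
    simpa only [add_zero, hyn, sub_zero] using h
  have hdetour := hitTime_le_pathCost_add hq0 hpos (m := n') (y := y)
    (fun j hj => hlatt j (by omega)) hz₀
  rw [hy0, hopt, pathCost_add] at hdetour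
  have hξ0 := hpos z₀ hz₀
  have hrate : 2 * (q * l1 (y n') / ξT z₀) ≤ q * l1 (y n') / c := by
    have hA : 0 ≤ q * l1 (y n') := mul_nonneg hq0 (l1_nonneg _)
    have h2c : 2 * c ≤ ξT z₀ := by rwa [hc, ← mul_div_assoc]
    rw [← mul_div_assoc, div_le_div_iff₀ hξ0 hc0]
    nlinarith
  have htri : q * l1 (y n' - z₀) / ξT z₀ ≤ q * l1 (y n') / ξT z₀ + q * l1 z₀ / ξT z₀ := by
    rw [← add_div, ← mul_add]
    gcongr
    exact l1_sub_le _ _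
  linarith
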